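/- arXiv:math/0303281 — 2 statements merged into one kernel-verified Lean document; each statement's English description precedes it below -/
import Mathlib

section
/- Let Θ ⊆ I. Every ∼_Θ-equivalence class on W × W contains exactly one pair (w₁, w₂) with w₁ ∈ W^{Θ∪Θ^⊥} and w₂ ∈ ^ΘW (the normal form II representative of the class). -/
open Classical

namespace Paper

variable {B : Type*} {M : CoxeterMatrix B} {W : Type*} [Group W]

/-- `Θ^⊥`: the indices whose simple reflections commute with all simple
reflections indexed by `Θ` (i.e. `m(i,j) = 2` for all `j ∈ Θ`). -/
def perp (M : CoxeterMatrix B) (Θ : Set B) : Set B := {i | i ∉ Θ ∧ ∀ j ∈ Θ, M i j = 2}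

variable (cs : CoxeterSystem M W)

/-- The standard parabolic subgroup `W_J` generated by the simple reflections indexed by `J`. -/
def parabolic (J : Set B) : Subgroup W := Subgroup.closure (cs.simple '' J)

/-- `W^J`: the minimal-length representatives of the cosets `W/W_J`,
`{w : ℓ(wu) = ℓ(w) + ℓ(u) for all u ∈ W_J}`. -/
def minRight (J : Set B) : Set W :=
  {w | ∀ u ∈ parabolic cs J, cs.length (w * u) = cs.length w + cs.length u}

/-- `^JW`: the minimal-length representatives of the cosets `W_J\W`,
`{w : ℓ(uw) = ℓ(u) + ℓ(w) for all u ∈ W_J}`. -/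
def minLeft (J : Set B) : Set W :=
  {w | ∀ u ∈ parabolic cs J, cs.length (u * w) = cs.length u + cs.length w}

/-- The Bruhat order on `W`: `x ≤ y` iff `y` is obtained from `x` by a chain of
right multiplications by reflections, each strictly increasing the length. -/
def bruhatLE : W → W → Prop :=
  Relation.ReflTransGen (fun x y => ∃ t, cs.IsReflection t ∧ y = x * t ∧ cs.length x < cs.length y)

/-- The equivalence relation `∼_Θ` on `W × W`:
`(x,y) ∼_Θ (x',y')` iff there are `u ∈ W_{Θ∪Θ^⊥}` and `v ∈ W_Θ` with `x' = xu`, `y' = u⁻¹vy`. -/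
def simRel (Θ : Set B) (p q : W × W) : Prop :=
  ∃ u ∈ parabolic cs (Θ ∪ perp M Θ), ∃ v ∈ parabolic cs Θ,
    q.1 = p.1 * u ∧ q.2 = u⁻¹ * v * p.2

/-- `w^J`: the minimal-length element of the coset `w W_J`. -/
noncomputable def projR (J : Set B) (w : W) : W :=
  if h : ∃ a, a ∈ minRight cs J ∧ a⁻¹ * w ∈ parabolic cs J then h.choose else w

/-- `^Jw`: the minimal-length element of the coset `W_J w`. -/
noncomputable def projL (J : Set B) (w : W) : W :=
  if h : ∃ a, a ∈ minLeft cs J ∧ w * a⁻¹ ∈ parabolic cs J then h.choose else w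

/-- The action of a simple reflection on `W × ZMod 2` whose extension to `W` records the parity of
multiplicities in right inversion sequences. -/
noncomputable def simpleParityAction (i : B) : Function.End (W × ZMod 2) := fun p =>
  (cs.simple i * p.1 * cs.simple i, p.2 + if p.1 = cs.simple i then 1 else 0)

theorem prod_simpleParityAction (ω : List B) (t : W) (e : ZMod 2) :
    (ω.map (simpleParityAction cs)).prod (t, e) =
      (cs.wordProd ω * t * (cs.wordProd ω)⁻¹, e + ((cs.rightInvSeq ω).count t : ZMod 2)) := by
  induction ω with
  | nil => simp [CoxeterSystem.rightInvSeq, Function.End.one_def]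
  | cons i ω ih =>
    have hiff : cs.wordProd ω * t * (cs.wordProd ω)⁻¹ = cs.simple i ↔
        (cs.wordProd ω)⁻¹ * cs.simple i * cs.wordProd ω = t := by
      constructor
      · intro h
        rw [← h]
        group
      · rintro rfl
        group
    rw [List.map_cons, List.prod_cons]
    change simpleParityAction cs i ((ω.map (simpleParityAction cs)).prod (t, e)) = _
    rw [ih]
    simp only [simpleParityAction, hiff, CoxeterSystem.rightInvSeq, List.count_cons, beq_iff_eq,
      cs.wordProd_cons]
    ext
    · simp [mul_assoc]
    · push_cast
      simp only [add_assoc]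

theorem count_leftInvSeq_alternatingWord_eq_zero (i j : B) (t : W) :
    ((cs.leftInvSeq (CoxeterSystem.alternatingWord j i (2 * M i j))).count t : ZMod 2) = 0 := by
  have hL : cs.leftInvSeq (CoxeterSystem.alternatingWord j i (2 * M i j)) =
      (List.range (M i j + M i j)).map
        (fun k => cs.wordProd (CoxeterSystem.alternatingWord i j (2 * k + 1))) := by
    apply List.ext_getElem
    · simp [two_mul]
    · intro k h₁ h₂
      rw [cs.getElem_leftInvSeq_alternatingWord j i (M i j) k (by simpa using h₁)]
      simp
  have hper : (fun k => cs.wordProd (CoxeterSystem.alternatingWord i j (2 * k + 1))) ∘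
      (fun k => M i j + k) =
      fun k => cs.wordProd (CoxeterSystem.alternatingWord i j (2 * k + 1)) := by
    funext k
    have h₁ : (2 * (M i j + k) + 1) / 2 = M i j + k := by lia
    have h₂ : (2 * k + 1) / 2 = k := by lia
    simp [cs.prod_alternatingWord_eq_mul_pow, h₁, h₂, pow_add]
  rw [hL, List.range_add, List.map_append, List.map_map, hper, List.count_append, Nat.cast_add]
  exact CharTwo.add_self_eq_zero _

theorem isLiftable_simpleParityAction : M.IsLiftable (simpleParityAction cs) := by
  intro i j
  have hpow : ∀ m : ℕ, (simpleParityAction cs i * simpleParityAction cs j) ^ m =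
      ((CoxeterSystem.alternatingWord j i (2 * m)).reverse.map (simpleParityAction cs)).prod := by
    intro m
    induction m with
    | zero => simp [CoxeterSystem.alternatingWord]
    | succ m ih =>
      rw [pow_succ', ih, show 2 * (m + 1) = 2 * m + 1 + 1 by ring,
        CoxeterSystem.alternatingWord_succ, CoxeterSystem.alternatingWord_succ]
      simp [mul_assoc]
  funext ⟨t, e⟩
  have hprod : cs.wordProd (CoxeterSystem.alternatingWord j i (2 * M i j)) = 1 := by
    rw [cs.prod_alternatingWord_eq_mul_pow, M.symmetric i j]
    simp
  rw [hpow, prod_simpleParityAction, cs.rightInvSeq_reverse, List.count_reverse,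
    count_leftInvSeq_alternatingWord_eq_zero, cs.wordProd_reverse, hprod]
  simp [Function.End.one_def]

/-- The parity action of `W` on `W × ZMod 2`. -/
noncomputable def parityAction : W →* Function.End (W × ZMod 2) :=
  cs.lift ⟨simpleParityAction cs, isLiftable_simpleParityAction cs⟩

theorem parityAction_wordProd (ω : List B) (t : W) (e : ZMod 2) :
    parityAction cs (cs.wordProd ω) (t, e) =
      (cs.wordProd ω * t * (cs.wordProd ω)⁻¹, e + ((cs.rightInvSeq ω).count t : ZMod 2)) := by
  rw [← prod_simpleParityAction, CoxeterSystem.wordProd, map_list_prod, List.map_map]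
  have h : parityAction cs ∘ cs.simple = simpleParityAction cs :=
    funext fun i => cs.lift_apply_simple _ i
  rw [h]

theorem count_rightInvSeq_congr {ω ω' : List B} (h : cs.wordProd ω = cs.wordProd ω') (t : W) :
    ((cs.rightInvSeq ω).count t : ZMod 2) = (cs.rightInvSeq ω').count t := by
  have := parityAction_wordProd cs ω t 0
  rw [h, parityAction_wordProd] at this
  simpa using (congrArg Prod.snd this).symm

/-- The exchange condition: a right descent of `π ω` occurs in the right inversion sequence
of `ω`. -/
theorem simple_mem_rightInvSeq {ω : List B} {i : B} (h : cs.IsRightDescent (cs.wordProd ω) i) :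
    cs.simple i ∈ cs.rightInvSeq ω := by
  obtain ⟨α, hα, hαω⟩ := cs.exists_isReduced (cs.wordProd ω * cs.simple i)
  have hnot : cs.simple i ∉ cs.rightInvSeq α := by
    intro hmem
    have hlt := (cs.isRightInversion_of_mem_rightInvSeq hα hmem).2
    rw [← hαω] at hlt
    simp only [CoxeterSystem.IsRightDescent] at h
    simp at hlt
    lia
  have hprod : cs.wordProd ω = cs.wordProd (α.concat i) := by
    rw [cs.wordProd_concat, ← hαω]
    simp
  have hc := count_rightInvSeq_congr cs hprod (cs.simple i)
  have hcount : ((cs.rightInvSeq α).map (MulAut.conj (cs.simple i))).count (cs.simple i) = 0 := by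
    rw [List.count_eq_zero]
    intro hmem
    obtain ⟨x, hx, hxi⟩ := List.mem_map.1 hmem
    have : x = cs.simple i := by
      apply (MulAut.conj (cs.simple i)).injective
      rw [hxi]
      simp
    exact hnot (this ▸ hx)
  rw [cs.rightInvSeq_concat, List.concat_eq_append, List.count_append, hcount] at hc
  by_contra hmem
  rw [List.count_eq_zero.2 hmem] at hc
  simp at hc

theorem exists_eraseIdx_of_isRightDescent {ω : List B} {i : B}
    (h : cs.IsRightDescent (cs.wordProd ω) i) :
    ∃ k < ω.length, cs.wordProd ω * cs.simple i = cs.wordProd (ω.eraseIdx k) := by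
  obtain ⟨k, hk, hki⟩ := List.getElem_of_mem (simple_mem_rightInvSeq cs h)
  refine ⟨k, by simpa using hk, ?_⟩
  rw [← cs.wordProd_mul_getD_rightInvSeq, ← hki, List.getD_eq_getElem _ _ hk]

theorem simple_mem_parabolic {J : Set B} {i : B} (hi : i ∈ J) :
    cs.simple i ∈ parabolic cs J :=
  Subgroup.subset_closure ⟨i, hi, rfl⟩

theorem wordProd_mem_parabolic {J : Set B} {ω : List B} (hω : ∀ i ∈ ω, i ∈ J) :
    cs.wordProd ω ∈ parabolic cs J := by
  induction ω with
  | nil => simp [one_mem]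
  | cons i ω ih =>
    rw [cs.wordProd_cons]
    exact mul_mem (simple_mem_parabolic cs (hω i (by simp)))
      (ih fun j hj => hω j (by simp [hj]))

theorem exists_word_of_mem_parabolic {J : Set B} {u : W} (hu : u ∈ parabolic cs J) :
    ∃ ω : List B, (∀ i ∈ ω, i ∈ J) ∧ cs.wordProd ω = u := by
  induction hu using Subgroup.closure_induction with
  | mem x hx =>
    obtain ⟨i, hi, rfl⟩ := hx
    exact ⟨[i], by simpa using hi, by simp⟩
  | one => exact ⟨[], by simp, by simp⟩
  | mul x y _ _ hx hy =>
    obtain ⟨α, hα, rfl⟩ := hx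
    obtain ⟨β, hβ, rfl⟩ := hy
    refine ⟨α ++ β, fun i hi => ?_, cs.wordProd_append α β⟩
    exact (List.mem_append.1 hi).elim (hα i) (hβ i)
  | inv x _ hx =>
    obtain ⟨α, hα, rfl⟩ := hx
    exact ⟨α.reverse, by simpa using hα, by simp⟩

/-- If `a` has minimal length in `aW_J`, appending a `J`-word adds its length, unless the word can
be shortened within `J`. -/
theorem length_mul_wordProd_or_exists_shorter {J : Set B} {a : W}
    (ha : ∀ u ∈ parabolic cs J, cs.length a ≤ cs.length (a * u))
    (ω : List B) (hω : ∀ i ∈ ω, i ∈ J) :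
    cs.length (a * cs.wordProd ω) = cs.length a + ω.length ∨
      ∃ ω' : List B, (∀ i ∈ ω', i ∈ J) ∧ ω'.length < ω.length ∧
        cs.wordProd ω' = cs.wordProd ω := by
  induction ω using List.reverseRecOn with
  | nil => simp
  | append_singleton ω i ih =>
    have hω₀ : ∀ j ∈ ω, j ∈ J := fun j hj => hω j (by simp [hj])
    have hi : i ∈ J := hω i (by simp)
    rcases ih hω₀ with hlen | ⟨ω', hω', hlt, heq⟩
    · have hassoc : a * cs.wordProd (ω ++ [i]) = a * cs.wordProd ω * cs.simple i := by
        simp [cs.wordProd_append, mul_assoc]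
      by_cases hd : cs.IsRightDescent (a * cs.wordProd ω) i
      · right
        obtain ⟨α, hα, rfl⟩ := cs.exists_isReduced a
        rw [← cs.wordProd_append] at hd
        obtain ⟨k, hk, hkeq⟩ := exists_eraseIdx_of_isRightDescent cs hd
        rcases lt_or_ge k α.length with hkα | hkα
        · exfalso
          rw [List.eraseIdx_append_of_lt_length hkα, cs.wordProd_append, cs.wordProd_append] at hkeq
          have hu : cs.wordProd ω * cs.simple i * (cs.wordProd ω)⁻¹ ∈ parabolic cs J :=
            mul_mem (mul_mem (wordProd_mem_parabolic cs hω₀) (simple_mem_parabolic cs hi))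
              (inv_mem (wordProd_mem_parabolic cs hω₀))
          have hmin := ha _ hu
          rw [← mul_assoc, ← mul_assoc, hkeq, mul_inv_cancel_right, hα.eq] at hmin
          have hle := cs.length_wordProd_le (α.eraseIdx k)
          have := List.length_eraseIdx_add_one hkα
          lia
        · rw [List.eraseIdx_append_of_length_le hkα, cs.wordProd_append, cs.wordProd_append,
            mul_assoc] at hkeq
          refine ⟨ω.eraseIdx (k - α.length), fun j hj => hω₀ j (List.mem_of_mem_eraseIdx hj), ?_, ?_⟩
          · have := List.length_eraseIdx_le ω (k - α.length)
            simp only [List.length_append, List.length_singleton]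
            lia
          · rw [← mul_left_cancel hkeq]
            simp [cs.wordProd_append]
      · left
        rw [hassoc, cs.not_isRightDescent_iff.1 hd, hlen]
        simp [add_assoc]
    · refine Or.inr ⟨ω' ++ [i], fun j hj => ?_, by simpa using hlt, ?_⟩
      · rcases List.mem_append.1 hj with hj | hj
        · exact hω' j hj
        · exact (List.mem_singleton.1 hj) ▸ hi
      · rw [cs.wordProd_append, cs.wordProd_append, heq]

theorem mem_minRight_of_forall_le {J : Set B} {a : W}
    (ha : ∀ u ∈ parabolic cs J, cs.length a ≤ cs.length (a * u)) : a ∈ minRight cs J := by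
  intro u hu
  have hex : ∃ n, ∃ ω : List B, (∀ i ∈ ω, i ∈ J) ∧ cs.wordProd ω = u ∧ ω.length = n := by
    obtain ⟨ω, hω, h⟩ := exists_word_of_mem_parabolic cs hu
    exact ⟨_, ω, hω, h, rfl⟩
  obtain ⟨ω, hω, hωu, hlen⟩ := Nat.find_spec hex
  have hadd : ∀ b : W, (∀ v ∈ parabolic cs J, cs.length b ≤ cs.length (b * v)) →
      cs.length (b * u) = cs.length b + ω.length := by
    intro b hb
    rw [← hωu]
    refine (length_mul_wordProd_or_exists_shorter cs hb ω hω).resolve_right ?_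
    rintro ⟨ω', hω', hlt, heq⟩
    exact Nat.find_min hex (hlen ▸ hlt) ⟨ω', hω', heq.trans hωu, rfl⟩
  have hone := hadd 1 (by simp)
  rw [one_mul, cs.length_one, zero_add] at hone
  rw [hadd a ha, hone]

theorem exists_mul_mem_minRight (J : Set B) (w : W) :
    ∃ u ∈ parabolic cs J, w * u ∈ minRight cs J := by
  obtain ⟨u, hu, hmin⟩ := exists_minimalFor_of_wellFoundedLT (· ∈ parabolic cs J)
    (fun u => cs.length (w * u)) ⟨1, one_mem _⟩
  refine ⟨u, hu, mem_minRight_of_forall_le cs fun v hv => ?_⟩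
  rw [mul_assoc]
  rcases le_total (cs.length (w * u)) (cs.length (w * (u * v))) with h | h
  · exact h
  · exact hmin (mul_mem hu hv) h

theorem eq_one_of_mul_mem_minRight {J : Set B} {a u : W} (hu : u ∈ parabolic cs J)
    (ha : a ∈ minRight cs J) (hau : a * u ∈ minRight cs J) : u = 1 := by
  have h₁ := ha u hu
  have h₂ := hau u⁻¹ (inv_mem hu)
  rw [mul_inv_cancel_right, cs.length_inv] at h₂
  exact cs.length_eq_zero_iff.1 (by lia)

theorem inv_mem_minRight_iff {J : Set B} {w : W} : w⁻¹ ∈ minRight cs J ↔ w ∈ minLeft cs J := by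
  constructor
  · intro h u hu
    have := h u⁻¹ (inv_mem hu)
    rw [← mul_inv_rev, cs.length_inv, cs.length_inv, cs.length_inv] at this
    rw [this, add_comm]
  · intro h u hu
    have := h u⁻¹ (inv_mem hu)
    rw [← cs.length_inv, mul_inv_rev, inv_inv, cs.length_inv] at this
    rw [this, cs.length_inv, add_comm]

theorem exists_mul_mem_minLeft (J : Set B) (w : W) :
    ∃ v ∈ parabolic cs J, v * w ∈ minLeft cs J := by
  obtain ⟨u, hu, h⟩ := exists_mul_mem_minRight cs J w⁻¹
  refine ⟨u⁻¹, inv_mem hu, (inv_mem_minRight_iff cs).1 ?_⟩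
  simpa using h

theorem eq_one_of_mul_mem_minLeft {J : Set B} {a v : W} (hv : v ∈ parabolic cs J)
    (ha : a ∈ minLeft cs J) (hva : v * a ∈ minLeft cs J) : v = 1 := by
  rw [← inv_mem_minRight_iff] at ha hva
  rw [mul_inv_rev] at hva
  exact inv_eq_one.1 (eq_one_of_mul_mem_minRight cs (inv_mem hv) ha hva)

theorem simple_commute_of_mem_perp {Θ : Set B} {i j : B} (hi : i ∈ perp M Θ) (hj : j ∈ Θ) :
    Commute (cs.simple i) (cs.simple j) := by
  have h := cs.simple_mul_simple_pow i j
  rw [hi.2 j hj, pow_two] at h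
  have := eq_inv_of_mul_eq_one_left h
  simpa [Commute, SemiconjBy] using this

theorem simple_conj_mem_parabolic {Θ : Set B} {i : B} (hi : i ∈ Θ ∪ perp M Θ) {v : W}
    (hv : v ∈ parabolic cs Θ) : cs.simple i * v * cs.simple i ∈ parabolic cs Θ := by
  rcases hi with hi | hi
  · have := simple_mem_parabolic cs hi
    exact mul_mem (mul_mem this hv) this
  · have hle : parabolic cs Θ ≤ Subgroup.centralizer {cs.simple i} := by
      rw [parabolic, Subgroup.closure_le]
      rintro _ ⟨j, hj, rfl⟩
      exact Subgroup.mem_centralizer_singleton_iff.2 (simple_commute_of_mem_perp cs hi hj).symm.eq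
    rw [← Subgroup.mem_centralizer_singleton_iff.1 (hle hv), mul_assoc, cs.simple_mul_simple_self,
      mul_one]
    exact hv

theorem conj_mem_parabolic_of_mem_union_perp {Θ : Set B} {u v : W}
    (hu : u ∈ parabolic cs (Θ ∪ perp M Θ)) (hv : v ∈ parabolic cs Θ) :
    u * v * u⁻¹ ∈ parabolic cs Θ := by
  obtain ⟨ω, hω, rfl⟩ := exists_word_of_mem_parabolic cs hu
  clear hu
  induction ω with
  | nil => simpa using hv
  | cons i ω ih =>
    have := simple_conj_mem_parabolic cs (hω i (by simp)) (ih fun j hj => hω j (by simp [hj]))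
    simpa [cs.wordProd_cons, mul_assoc] using this

/-- every `∼_Θ`-class contains exactly one pair `(w₁, w₂)` with
`w₁ ∈ W^{Θ∪Θ^⊥}` and `w₂ ∈ ^ΘW` (normal form II). -/
theorem statement3 [Finite B] (Θ : Set B) (p : W × W) :
    ∃! q : W × W, simRel cs Θ p q ∧
      q.1 ∈ minRight cs (Θ ∪ perp M Θ) ∧ q.2 ∈ minLeft cs Θ := by
  obtain ⟨u, hu, hmin⟩ := exists_mul_mem_minRight cs (Θ ∪ perp M Θ) p.1
  obtain ⟨v, hv, hvmin⟩ := exists_mul_mem_minLeft cs Θ (u⁻¹ * p.2)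
  refine ⟨(p.1 * u, v * (u⁻¹ * p.2)), ⟨⟨u, hu, u * v * u⁻¹,
    conj_mem_parabolic_of_mem_union_perp cs hu hv, rfl, by group⟩, hmin, hvmin⟩, ?_⟩
  rintro ⟨x, y⟩ ⟨⟨u', hu', v', hv', hx, hy⟩, hxmin, hymin⟩
  dsimp only at hx hy hxmin hymin
  have huu : u⁻¹ * u' = 1 := by
    refine eq_one_of_mul_mem_minRight cs (mul_mem (inv_mem hu) hu') hmin ?_
    rwa [mul_assoc, mul_inv_cancel_left, ← hx]
  obtain rfl : u = u' := inv_mul_eq_one.1 huu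
  have hconj := conj_mem_parabolic_of_mem_union_perp cs (inv_mem hu) hv'
  rw [inv_inv] at hconj
  have hvv : u⁻¹ * v' * u * v⁻¹ = 1 := by
    refine eq_one_of_mul_mem_minLeft cs (mul_mem hconj (inv_mem hv)) hvmin ?_
    convert hymin using 1
    rw [hy]
    group
  have hv_eq : u⁻¹ * v' * u = v := mul_inv_eq_one.1 hvv
  rw [hx, hy, ← hv_eq]
  simp [mul_assoc]

end Paper
end

section
/- Let Θ, Θ' ⊆ I, let w₁ ∈ W^Θ, w₂ ∈ ^{Θ∪Θ^⊥}W, w₁' ∈ W^{Θ'}, w₂' ∈ ^{Θ'∪Θ'^⊥}W. Assume Θ ⊇ Θ' and that there exists w ∈ W_{Θ'^⊥} with w₁ ≤ (w₁'w)^Θ and w₂ ≥ ^Θ(w⁻¹w₂') in the Bruhat order; assume also Θ' ⊇ Θ and that there exists w̃ ∈ W_{Θ^⊥} with w₁' ≤ (w₁w̃)^{Θ'} and w₂' ≥ ^{Θ'}(w̃⁻¹w₂) in the Bruhat order. Then Θ = Θ', w₁ = w₁' and w₂ = w₂'. (Antisymmetry of the extended Bruhat order ≤₊₊.) -/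
open Classical

namespace Paper

variable {B : Type*} {M : CoxeterMatrix B} {W : Type*} [Group W]

variable (cs : CoxeterSystem M W)

theorem bruhatLE.eq_or_length_lt {cs : CoxeterSystem M W} {x y : W} (h : bruhatLE cs x y) :
    x = y ∨ cs.length x < cs.length y := by
  unfold bruhatLE at h
  induction h with
  | refl => exact Or.inl rfl
  | tail _ hstep ih =>
    obtain ⟨t, -, -, hlt⟩ := hstep
    rcases ih with rfl | ih
    · exact Or.inr hlt
    · exact Or.inr (ih.trans hlt)

theorem bruhatLE.length_le {cs : CoxeterSystem M W} {x y : W} (h : bruhatLE cs x y) :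
    cs.length x ≤ cs.length y := by
  rcases h.eq_or_length_lt with rfl | h
  · exact le_rfl
  · exact h.le

theorem bruhatLE.eq_of_length_le {cs : CoxeterSystem M W} {x y : W} (h : bruhatLE cs x y)
    (hl : cs.length y ≤ cs.length x) : x = y :=
  h.eq_or_length_lt.resolve_right hl.not_gt

theorem parabolic_mono {J K : Set B} (h : J ⊆ K) : parabolic cs J ≤ parabolic cs K :=
  Subgroup.closure_mono (Set.image_mono h)

theorem projL_eq_mul (J : Set B) (x : W) : ∃ v ∈ parabolic cs J, projL cs J x = v * x := by
  unfold projL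
  split_ifs with h
  · refine ⟨_, inv_mem h.choose_spec.2, ?_⟩
    group
  · exact ⟨1, one_mem _, (one_mul x).symm⟩

/-- The minimal-length representative of a coset `w W_J` is unique. -/
theorem minRight_unique {J : Set B} {a b : W} (ha : a ∈ minRight cs J) (hb : b ∈ minRight cs J)
    (h : a⁻¹ * b ∈ parabolic cs J) : a = b := by
  have h₁ := ha _ h
  have h₂ := hb _ (inv_mem h)
  rw [mul_inv_cancel_left] at h₁
  rw [mul_inv_rev, inv_inv, mul_inv_cancel_left] at h₂
  exact inv_mul_eq_one.1 (cs.length_eq_zero_iff.1 (by lia))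

theorem projR_mul_eq {J : Set B} {a u : W} (ha : a ∈ minRight cs J) (hu : u ∈ parabolic cs J) :
    projR cs J (a * u) = a := by
  have h : ∃ b, b ∈ minRight cs J ∧ b⁻¹ * (a * u) ∈ parabolic cs J :=
    ⟨a, ha, by rwa [inv_mul_cancel_left]⟩
  unfold projR
  rw [dif_pos h]
  refine minRight_unique cs h.choose_spec.1 ha ?_
  rw [← Subgroup.mul_mem_cancel_right _ hu, mul_assoc]
  exact h.choose_spec.2

/-- Every element of `W_J w⁻¹ y` with `w ∈ W_{J^⊥}` and `y ∈ ^{J ∪ J^⊥}W` has length at least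
`ℓ(y)`; if equality holds for `^J(w⁻¹ y)`, then this element is `y` and `w ∈ W_J`. -/
theorem length_le_projL {J : Set B} {w y : W} (hy : y ∈ minLeft cs (J ∪ perp M J))
    (hw : w ∈ parabolic cs (perp M J)) :
    cs.length y ≤ cs.length (projL cs J (w⁻¹ * y)) ∧
      (cs.length (projL cs J (w⁻¹ * y)) ≤ cs.length y →
        projL cs J (w⁻¹ * y) = y ∧ w ∈ parabolic cs J) := by
  obtain ⟨v, hv, h⟩ := projL_eq_mul cs J (w⁻¹ * y)
  have hvw : v * w⁻¹ ∈ parabolic cs (J ∪ perp M J) :=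
    mul_mem (parabolic_mono cs Set.subset_union_left hv)
      (inv_mem (parabolic_mono cs Set.subset_union_right hw))
  rw [h, ← mul_assoc, hy _ hvw]
  refine ⟨Nat.le_add_left _ _, fun hle => ?_⟩
  have h₁ : v * w⁻¹ = 1 := cs.length_eq_zero_iff.1 (by lia)
  exact ⟨by rw [h₁, one_mul], mul_inv_eq_one.1 h₁ ▸ hv⟩

/-- antisymmetry of the extended Bruhat order `≤₊₊`
(for elements in normal form I, described combinatorially). -/
theorem statement7 [Finite B] (Θ Θ' : Set B) (w₁ w₂ w₁' w₂' : W)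
    (h₁ : w₁ ∈ minRight cs Θ) (h₂ : w₂ ∈ minLeft cs (Θ ∪ perp M Θ))
    (h₁' : w₁' ∈ minRight cs Θ') (h₂' : w₂' ∈ minLeft cs (Θ' ∪ perp M Θ'))
    (hsub : Θ' ⊆ Θ)
    (h : ∃ w ∈ parabolic cs (perp M Θ'),
        bruhatLE cs w₁ (projR cs Θ (w₁' * w)) ∧ bruhatLE cs (projL cs Θ (w⁻¹ * w₂')) w₂)
    (hsub' : Θ ⊆ Θ')
    (h' : ∃ w ∈ parabolic cs (perp M Θ),
        bruhatLE cs w₁' (projR cs Θ' (w₁ * w)) ∧ bruhatLE cs (projL cs Θ' (w⁻¹ * w₂)) w₂') :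
    Θ = Θ' ∧ w₁ = w₁' ∧ w₂ = w₂' := by
  obtain rfl : Θ = Θ' := hsub'.antisymm hsub
  obtain ⟨w, hw, hle₁, hle₂⟩ := h
  obtain ⟨z, hz, hle₁', hle₂'⟩ := h'
  obtain ⟨hl, heq⟩ := length_le_projL cs h₂' hw
  obtain ⟨hl', heq'⟩ := length_le_projL cs h₂ hz
  have hb := hle₂.length_le
  have hb' := hle₂'.length_le
  obtain ⟨hp, hwJ⟩ := heq (by lia)
  obtain ⟨-, hzJ⟩ := heq' (by lia)
  rw [projR_mul_eq cs h₁' hwJ] at hle₁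
  rw [projR_mul_eq cs h₁ hzJ] at hle₁'
  rw [hp] at hle₂
  exact ⟨rfl, hle₁.eq_of_length_le hle₁'.length_le, (hle₂.eq_of_length_le (by lia)).symm⟩

end Paper
end
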